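/- Let φ : ℕ → ℝ⁺ be an increasing function such that φ(n+1)/φ(n) → ∞ as n → ∞, and let x ∈ L(φ). Then for every ε ∈ (0, 1/3), for all sufficiently large n one has (1 − ε)·φ(n) < a_n(x)·a_{n+1}(x) < (1 + ε)·φ(n), and moreover a_n(x)·a_{n+1}(x) = L_n(x). -/

import Mathlib

open Filter Set
open scoped ENNReal

/-- The Gauss map. -/
noncomputable def gaussMap (x : ℝ) : ℝ := Int.fract (1 / x)

/-- The `n`-th partial quotient `a_n(x)` (for `n ≥ 1`) of the continued fraction
expansion of `x ∈ (0,1)`. -/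
noncomputable def pq (x : ℝ) (n : ℕ) : ℕ := ⌊1 / (gaussMap^[n - 1] x)⌋₊

/-- `L_n(x) = max_{1 ≤ i ≤ n} a_i(x) a_{i+1}(x)`. -/
noncomputable def Lmax (x : ℝ) (n : ℕ) : ℕ :=
  (Finset.Icc 1 n).sup fun i => pq x i * pq x (i + 1)

/-- The level set `L(φ)` of irrational `x ∈ (0,1)` with `L_n(x)/φ(n) → 1`. -/
def Lset (φ : ℕ → ℝ) : Set ℝ :=
  {x | x ∈ Ioo (0 : ℝ) 1 ∧ Irrational x ∧
    Tendsto (fun n => (Lmax x n : ℝ) / φ n) atTop (nhds 1)}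

/-- `f` is regularly increasing with (finite) index `ρ`. -/
def RegInc (f : ℝ → ℝ) (ρ : ℝ) : Prop :=
  ∃ c > (0 : ℝ), ∃ f' : ℝ → ℝ,
    (∀ x ∈ Ici c, 0 < f x) ∧
    (∀ x ∈ Ici c, HasDerivAt f (f' x) x) ∧
    ContinuousOn f' (Ici c) ∧
    (∀ x ∈ Ici c, 0 < f' x) ∧
    Tendsto f atTop atTop ∧
    Tendsto (fun x => x * f' x / f x) atTop (nhds ρ)

/-- `f` is regularly increasing with index `∞`. -/
def RegIncTop (f : ℝ → ℝ) : Prop :=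
  ∃ c > (0 : ℝ), ∃ f' : ℝ → ℝ,
    (∀ x ∈ Ici c, 0 < f x) ∧
    (∀ x ∈ Ici c, HasDerivAt f (f' x) x) ∧
    ContinuousOn f' (Ici c) ∧
    (∀ x ∈ Ici c, 0 < f' x) ∧
    Tendsto f atTop atTop ∧
    Tendsto (fun x => x * f' x / f x) atTop atTop

/-- `L_{n+1}(x)` is the maximum of the new product and `L_n(x)`. -/
theorem Lmax_succ (x : ℝ) (n : ℕ) :
    Lmax x (n + 1) = max (pq x (n + 1) * pq x (n + 1 + 1)) (Lmax x n) := by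
  unfold Lmax
  rw [← Finset.insert_Icc_right_eq_Icc_add_one (by omega), Finset.sup_insert]

/-- The covering step of the upper bound in the case `1 < ρ ≤ ∞`: if
`φ(n+1)/φ(n) → ∞` and `x ∈ L(φ)`, then for every `ε ∈ (0, 1/3)` eventually
`(1-ε) φ(n) < a_n(x) a_{n+1}(x) < (1+ε) φ(n)` and `a_n(x) a_{n+1}(x) = L_n(x)`. -/
theorem statement16 (φ : ℕ → ℝ)
    (hφpos : ∀ n, 0 < φ n) (hφmono : Monotone φ)
    (hratio : Tendsto (fun n => φ (n + 1) / φ n) atTop atTop)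
    (x : ℝ) (hx : x ∈ Lset φ)
    (ε : ℝ) (hε0 : 0 < ε) (hε : ε < 1 / 3) :
    ∀ᶠ n : ℕ in atTop,
      (1 - ε) * φ n < (pq x n * pq x (n + 1) : ℕ) ∧
      ((pq x n * pq x (n + 1) : ℕ) : ℝ) < (1 + ε) * φ n ∧
      pq x n * pq x (n + 1) = Lmax x n := by
  obtain ⟨-, -, hlim⟩ := hx
  have hnear : ∀ᶠ n : ℕ in atTop,
      (1 - ε) * φ n < (Lmax x n : ℝ) ∧ (Lmax x n : ℝ) < (1 + ε) * φ n := by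
    filter_upwards [hlim.eventually (Ioo_mem_nhds (sub_lt_self 1 hε0) (lt_add_of_pos_right 1 hε0))]
      with n hn
    exact ⟨(lt_div_iff₀ (hφpos n)).1 hn.1, (div_lt_iff₀ (hφpos n)).1 hn.2⟩
  have hsucc : ∀ᶠ n : ℕ in atTop,
      pq x (n + 1) * pq x (n + 1 + 1) = Lmax x (n + 1) := by
    filter_upwards [hnear, (tendsto_add_atTop_nat 1).eventually hnear,
      hratio.eventually_ge_atTop 2] with n h₁ h₂ h₃
    have hφ : 2 * φ n ≤ φ (n + 1) := (le_div_iff₀ (hφpos n)).1 h₃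
    have hlt : (Lmax x n : ℝ) < Lmax x (n + 1) := by
      nlinarith [h₁.2, h₂.1, hφpos n, hφpos (n + 1)]
    have hlt : Lmax x n < Lmax x (n + 1) := by exact_mod_cast hlt
    rw [Lmax_succ] at hlt ⊢
    exact (max_eq_left ((lt_sup_iff.1 hlt).resolve_right (lt_irrefl _)).le).symm
  obtain ⟨N, hN⟩ := eventually_atTop.1 hsucc
  filter_upwards [hnear, eventually_ge_atTop (N + 1)] with n hn hle
  obtain ⟨m, rfl⟩ := Nat.exists_eq_add_of_le' (le_trans (Nat.le_add_left 1 N) hle)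
  have heq := hN m (by omega)
  exact ⟨heq ▸ hn.1, heq ▸ hn.2, heq⟩
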